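/- Let R be a commutative ring and let A, A', B, B' be chain complexes of flat R-modules. If u : A → A' and v : B → B' are quasi-isomorphisms between complexes of flat modules, then u ⊗ v : A ⊗ B → A' ⊗ B' is a quasi-isomorphism. -/

import Mathlib

open DirectSum TensorProduct

noncomputable section

/-- Index set for total degree `n`: pairs `(q,p)` with `q+p=n`. -/
abbrev Idx (n : ℕ) := {x : ℕ × ℕ // x.1 + x.2 = n}

variable (R : Type) [CommRing R]

section Graded

variable (M N M' N' : ℕ → Type)
variable [∀ n, AddCommGroup (M n)] [∀ n, Module R (M n)]
variable [∀ n, AddCommGroup (N n)] [∀ n, Module R (N n)]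
variable [∀ n, AddCommGroup (M' n)] [∀ n, Module R (M' n)]
variable [∀ n, AddCommGroup (N' n)] [∀ n, Module R (N' n)]

/-- Degree `n` part of the (graded) tensor product of two graded modules. -/
abbrev gradedTensor (n : ℕ) : Type := ⨁ (ab : Idx n), M ab.1.1 ⊗[R] N ab.1.2

variable {M N M' N'}

/-- Cast along an equality of degrees. -/
noncomputable def lcast {m m' : ℕ} (h : m = m') : M m →ₗ[R] M m' := by subst h; exact LinearMap.id

/-- Functoriality of the graded tensor product. -/
noncomputable def gmap (f : ∀ n, M n →ₗ[R] M' n) (g : ∀ n, N n →ₗ[R] N' n) (n : ℕ) :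
    gradedTensor R M N n →ₗ[R] gradedTensor R M' N' n :=
  DirectSum.toModule R _ _ fun ab =>
    (DirectSum.lof R (Idx n) _ ab).comp (TensorProduct.map (f ab.1.1) (g ab.1.2))

/-- Component of the differential of a tensor product of complexes (Koszul signs). -/
noncomputable def gtdAux (dM : ∀ n, M (n + 1) →ₗ[R] M n) (dN : ∀ n, N (n + 1) →ₗ[R] N n)
    (n a b : ℕ) (h : a + b = n + 1) : M a ⊗[R] N b →ₗ[R] gradedTensor R M N n :=
  (match a, h with
   | 0, _ => 0
   | (a' + 1), h =>
     (DirectSum.lof R (Idx n) _ ⟨(a', b), by omega⟩).comp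
       (TensorProduct.map (dM a') LinearMap.id))
  +
  (match b, h with
   | 0, _ => 0
   | (b' + 1), h =>
     ((-1 : ℤ) ^ a) •
       (DirectSum.lof R (Idx n) _ ⟨(a, b'), by omega⟩).comp
         (TensorProduct.map LinearMap.id (dN b')))

/-- The differential on the (graded) tensor product of two complexes:
`d ⊗ 1 + (-1)^a (1 ⊗ d)`. -/
noncomputable def gradedTensorD (dM : ∀ n, M (n + 1) →ₗ[R] M n) (dN : ∀ n, N (n + 1) →ₗ[R] N n) (n : ℕ) :
    gradedTensor R M N (n + 1) →ₗ[R] gradedTensor R M N n :=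
  DirectSum.toModule R _ _ fun ab => gtdAux R dM dN n ab.1.1 ab.1.2 ab.2

end Graded

section QIso

variable {M N : ℕ → Type}
variable [∀ n, AddCommGroup (M n)] [∀ n, Module R (M n)]
variable [∀ n, AddCommGroup (N n)] [∀ n, Module R (N n)]

/-- Cycles in a nonnegatively graded chain complex (every element is a cycle in degree 0). -/
noncomputable def IsCycleF (d : ∀ n, M (n + 1) →ₗ[R] M n) : ∀ n, M n → Prop
  | 0, _ => True
  | (n + 1), x => d n x = 0

/-- Boundaries in a nonnegatively graded chain complex. -/
noncomputable def IsBoundaryF (d : ∀ n, M (n + 1) →ₗ[R] M n) (n : ℕ) (x : M n) : Prop := ∃ y, d n y = x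

/-- A family of maps is a quasi-isomorphism: it induces a bijection on homology,
expressed elementwise. -/
noncomputable def IsQIsoF (dM : ∀ n, M (n + 1) →ₗ[R] M n) (dN : ∀ n, N (n + 1) →ₗ[R] N n)
    (f : ∀ n, M n →ₗ[R] N n) : Prop :=
  ∀ n,
    (∀ x : M n, IsCycleF R dM n x → IsBoundaryF R dN n (f n x) → IsBoundaryF R dM n x) ∧
    (∀ y : N n, IsCycleF R dN n y →
      ∃ x : M n, IsCycleF R dM n x ∧ IsBoundaryF R dN n (f n x - y))

end QIso


section Helpers

/-- Exactness of the mapping cone, elementwise. -/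
def ConeExact {M N : ℕ → Type}
    [∀ n, AddCommGroup (M n)] [∀ n, Module R (M n)]
    [∀ n, AddCommGroup (N n)] [∀ n, Module R (N n)]
    (dM : ∀ n, M (n + 1) →ₗ[R] M n) (dN : ∀ n, N (n + 1) →ₗ[R] N n)
    (f : ∀ n, M n →ₗ[R] N n) : Prop :=
  (∀ y : N 0, ∃ (x : M 0) (y' : N 1), f 0 x - y = dN 0 y') ∧
  ∀ n (x : M n) (y : N (n + 1)), IsCycleF R dM n x → f n x = dN n y →
    ∃ (x' : M (n + 1)) (y' : N (n + 2)), dM n x' = x ∧ f (n + 1) x' - y = dN (n + 1) y'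

section
variable {R}
variable {M N P : ℕ → Type}
variable [∀ n, AddCommGroup (M n)] [∀ n, Module R (M n)]
variable [∀ n, AddCommGroup (N n)] [∀ n, Module R (N n)]
variable [∀ n, AddCommGroup (P n)] [∀ n, Module R (P n)]
variable {dM : ∀ n, M (n + 1) →ₗ[R] M n} {dN : ∀ n, N (n + 1) →ₗ[R] N n}
  {dP : ∀ n, P (n + 1) →ₗ[R] P n}
  {f : ∀ n, M n →ₗ[R] N n} {g : ∀ n, N n →ₗ[R] P n}

lemma IsCycleF.sub {n : ℕ} {x y : M n} (hx : IsCycleF R dM n x) (hy : IsCycleF R dM n y) :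
    IsCycleF R dM n (x - y) := by
  cases n with
  | zero => trivial
  | succ n => simp only [IsCycleF, map_sub] at *; rw [hx, hy, sub_zero]

lemma IsCycleF.bdry (h : ∀ n, (dM n).comp (dM (n + 1)) = 0) {n : ℕ} (x : M (n + 1)) :
    IsCycleF R dM n (dM n x) := by
  cases n with
  | zero => trivial
  | succ n => exact LinearMap.congr_fun (h n) x

lemma IsCycleF.map (hf : ∀ n, (f n).comp (dM n) = (dN n).comp (f (n + 1))) {n : ℕ} {x : M n}
    (hx : IsCycleF R dM n x) : IsCycleF R dN n (f n x) := by
  cases n with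
  | zero => trivial
  | succ n =>
    have := LinearMap.congr_fun (hf n) x
    simp only [LinearMap.comp_apply] at this
    simp only [IsCycleF] at *
    rw [← this, hx, map_zero]

lemma ConeExact.of_qiso (hf : ∀ n, (f n).comp (dM n) = (dN n).comp (f (n + 1)))
    (h : IsQIsoF R dM dN f) : ConeExact R dM dN f := by
  constructor
  · intro y
    obtain ⟨x, -, y', hy'⟩ := (h 0).2 y trivial
    exact ⟨x, y', hy'.symm⟩
  · intro n x y hx hxy
    obtain ⟨x0, hx0⟩ := (h n).1 x hx ⟨y, hxy.symm⟩
    have hc : IsCycleF R dN (n + 1) (f (n + 1) x0 - y) := by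
      have := LinearMap.congr_fun (hf n) x0
      simp only [LinearMap.comp_apply] at this
      simp only [IsCycleF, map_sub]
      rw [← this, hx0, hxy, sub_self]
    obtain ⟨z, hz, w, hw⟩ := (h (n + 1)).2 _ hc
    refine ⟨x0 - z, -w, ?_, ?_⟩
    · simp only [IsCycleF] at hz
      rw [map_sub, hx0, hz, sub_zero]
    · rw [map_neg, hw, map_sub]; abel

lemma ConeExact.qiso (h : ConeExact R dM dN f) : IsQIsoF R dM dN f := by
  intro n
  constructor
  · rintro x hx ⟨y, hy⟩
    obtain ⟨x', y', h1, h2⟩ := h.2 n x y hx hy.symm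
    exact ⟨x', h1⟩
  · intro y hy
    cases n with
    | zero =>
      obtain ⟨x, y', h1⟩ := h.1 y
      exact ⟨x, trivial, y', h1.symm⟩
    | succ n =>
      have h0 : IsCycleF R dM n 0 := by cases n <;> simp [IsCycleF]
      obtain ⟨x', y', h1, h2⟩ := h.2 n 0 y h0 (by rw [map_zero]; exact hy.symm)
      exact ⟨x', h1, y', h2.symm⟩

lemma IsQIsoF.comp (h : IsQIsoF R dM dN f)
    (hf : ∀ n, (f n).comp (dM n) = (dN n).comp (f (n + 1)))
    (hg : ∀ n, (g n).comp (dN n) = (dP n).comp (g (n + 1))) (h' : IsQIsoF R dN dP g) :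
    IsQIsoF R dM dP (fun n => (g n).comp (f n)) := by
  intro n
  constructor
  · intro x hx hb
    exact (h n).1 x hx ((h' n).1 _ (hx.map hf) hb)
  · intro z hz
    obtain ⟨y, hy, w, hw⟩ := (h' n).2 z hz
    obtain ⟨x, hx, w', hw'⟩ := (h n).2 y hy
    refine ⟨x, hx, w + g (n + 1) w', ?_⟩
    have := LinearMap.congr_fun (hg n) w'
    simp only [LinearMap.comp_apply] at this
    rw [map_add, ← this, hw, hw', map_sub, LinearMap.comp_apply]; abel

lemma ConeExact.smul (s : ℤ) (hs : s * s = 1) (h : ConeExact R dM dN f) :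
    ConeExact R (fun n => s • dM n) (fun n => s • dN n) f := by
  have hss : ∀ {Q : Type} [AddCommGroup Q] (q : Q), s • s • q = q := by
    intro Q _ q; rw [smul_smul, hs, one_smul]
  constructor
  · intro y
    obtain ⟨x, y', hy⟩ := h.1 y
    exact ⟨x, s • y', by rw [hy, LinearMap.smul_apply, map_zsmul, hss]⟩
  · intro n x y hx hxy
    obtain ⟨x', y', h1, h2⟩ := h.2 n x (s • y) (by
      cases n with
      | zero => trivial
      | succ n =>
        simp only [IsCycleF, LinearMap.smul_apply] at *
        rw [← hss (dM n x), hx, smul_zero]) (by rw [hxy, map_zsmul]; rfl)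
    refine ⟨s • x', y', ?_, ?_⟩
    · rw [LinearMap.smul_apply, map_zsmul, hss, h1]
    · rw [LinearMap.smul_apply, ← h2, map_zsmul, smul_sub, hss]
end

section Flat
variable {R}
variable {Q K M M1 N0 N1 N2 : Type} [AddCommGroup Q] [Module R Q] [AddCommGroup K] [Module R K]
  [AddCommGroup M] [Module R M] [AddCommGroup M1] [Module R M1] [AddCommGroup N0] [Module R N0]
  [AddCommGroup N1] [Module R N1] [AddCommGroup N2] [Module R N2] [Module.Flat R Q]

lemma lT_aux (z : M →ₗ[R] K) (f : M →ₗ[R] N0) (d : N1 →ₗ[R] N0) (e : M1 →ₗ[R] M)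
    (f1 : M1 →ₗ[R] N1) (d1 : N2 →ₗ[R] N1)
    (hz : z.comp e = 0) (hd : d.comp d1 = 0) (hf : f.comp e = d.comp f1)
    (H : ∀ x y, z x = 0 → f x = d y → ∃ x' y', e x' = x ∧ f1 x' - y = d1 y')
    (x : Q ⊗[R] M) (y : Q ⊗[R] N1) (hx : z.lTensor Q x = 0)
    (hxy : f.lTensor Q x = d.lTensor Q y) :
    ∃ x' y', e.lTensor Q x' = x ∧ f1.lTensor Q x' - y = d1.lTensor Q y' := by
  let c : M1 × N2 →ₗ[R] M × N1 := (e.comp (.fst R _ _)).prod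
    (f1.comp (.fst R _ _) - d1.comp (.snd R _ _))
  let k : M × N1 →ₗ[R] K × N0 := (z.comp (.fst R _ _)).prod
    (f.comp (.fst R _ _) - d.comp (.snd R _ _))
  have hex : Function.Exact c k := by
    rintro ⟨a, b⟩
    constructor
    · intro h
      have h : z a = 0 ∧ f a - d b = 0 := Prod.mk_eq_zero.1 h
      obtain ⟨x', y', h1, h2⟩ := H a b h.1 (sub_eq_zero.1 h.2)
      refine ⟨(x', y'), ?_⟩
      simp [c, h1, ← h2]
    · rintro ⟨⟨x', y'⟩, h⟩
      rw [← h]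
      have h1 := LinearMap.congr_fun hz x'
      have h2 := LinearMap.congr_fun hd y'
      have h3 := LinearMap.congr_fun hf x'
      simp only [LinearMap.comp_apply, LinearMap.zero_apply] at h1 h2 h3
      simp [c, k, h1, h2, h3]
  have hexT := Module.Flat.lTensor_exact Q hex
  have hk : k.lTensor Q ((LinearMap.inl R M N1).lTensor Q x + (LinearMap.inr R M N1).lTensor Q y)
      = 0 := by
    have e1 : k.comp (LinearMap.inl R M N1) = (LinearMap.inl R K N0).comp z +
        (LinearMap.inr R K N0).comp f := by
      ext <;> simp [k]
    have e2 : k.comp (LinearMap.inr R M N1) = -(LinearMap.inr R K N0).comp d := by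
      ext <;> simp [k]
    rw [map_add, ← LinearMap.lTensor_comp_apply, ← LinearMap.lTensor_comp_apply, e1, e2,
      LinearMap.lTensor_add, LinearMap.lTensor_neg, LinearMap.add_apply, LinearMap.neg_apply,
      LinearMap.lTensor_comp_apply, LinearMap.lTensor_comp_apply, LinearMap.lTensor_comp_apply,
      hx, hxy, map_zero]
    abel
  obtain ⟨w, hw⟩ := (hexT _).1 hk
  refine ⟨(LinearMap.fst R M1 N2).lTensor Q w, (LinearMap.snd R M1 N2).lTensor Q w, ?_, ?_⟩
  · have := congrArg ((LinearMap.fst R M N1).lTensor Q) hw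
    rw [map_add, ← LinearMap.lTensor_comp_apply, ← LinearMap.lTensor_comp_apply,
      ← LinearMap.lTensor_comp_apply, LinearMap.fst_comp_inl, LinearMap.fst_comp_inr,
      LinearMap.lTensor_id, LinearMap.lTensor_zero, LinearMap.fst_prod] at this
    simpa [LinearMap.lTensor_comp_apply] using this
  · have := congrArg ((LinearMap.snd R M N1).lTensor Q) hw
    rw [map_add, ← LinearMap.lTensor_comp_apply, ← LinearMap.lTensor_comp_apply,
      ← LinearMap.lTensor_comp_apply, LinearMap.snd_comp_inl, LinearMap.snd_comp_inr,
      LinearMap.lTensor_id, LinearMap.lTensor_zero, LinearMap.snd_prod, LinearMap.lTensor_sub] at this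
    simp only [LinearMap.sub_apply, LinearMap.lTensor_comp_apply, LinearMap.zero_apply,
      LinearMap.id_apply, zero_add] at this
    rw [← this]; abel

end Flat

section Flat2
variable {R}
variable {Q : Type} [AddCommGroup Q] [Module R Q] [Module.Flat R Q]
variable {M N : ℕ → Type}
variable [∀ n, AddCommGroup (M n)] [∀ n, Module R (M n)]
variable [∀ n, AddCommGroup (N n)] [∀ n, Module R (N n)]
variable {dM : ∀ n, M (n + 1) →ₗ[R] M n} {dN : ∀ n, N (n + 1) →ₗ[R] N n}
  {f : ∀ n, M n →ₗ[R] N n}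

lemma ConeExact.lTensor (hM : ∀ n, (dM n).comp (dM (n + 1)) = 0)
    (hN : ∀ n, (dN n).comp (dN (n + 1)) = 0)
    (hf : ∀ n, (f n).comp (dM n) = (dN n).comp (f (n + 1)))
    (h : ConeExact R dM dN f) :
    ConeExact R (M := fun n => Q ⊗[R] M n) (N := fun n => Q ⊗[R] N n)
      (fun n => (dM n).lTensor Q) (fun n => (dN n).lTensor Q) (fun n => (f n).lTensor Q) := by
  constructor
  · intro y
    obtain ⟨x', y', -, h2⟩ := lT_aux (Q := Q) (0 : PUnit.{1} →ₗ[R] M 0) (0 : PUnit.{1} →ₗ[R] N 0)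
      (0 : N 0 →ₗ[R] N 0)
      (0 : M 0 →ₗ[R] PUnit.{1}) (f 0) (dN 0) (by simp) (by simp) (by simp)
      (fun x y _ _ => by
        obtain ⟨x', y', h'⟩ := h.1 y
        exact ⟨x', y', rfl, h'⟩) 0 y (by simp) (by simp)
    exact ⟨x', y', h2⟩
  · intro n x y hx hxy
    cases n with
    | zero =>
      exact lT_aux (Q := Q) (0 : M 0 →ₗ[R] M 0) (f 0) (dN 0) (dM 0) (f 1) (dN 1) (by simp)
        (hN 0) (hf 0) (fun x y _ hxy => h.2 0 x y trivial hxy) x y (by simp) hxy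
    | succ n =>
      exact lT_aux (Q := Q) (dM n) (f (n + 1)) (dN (n + 1)) (dM (n + 1)) (f (n + 2)) (dN (n + 2))
        (hM n) (hN (n + 1)) (hf (n + 1)) (fun x y h1 hxy => h.2 (n + 1) x y h1 hxy) x y hx hxy

lemma ConeExact.transport {M' N' : ℕ → Type}
    [∀ n, AddCommGroup (M' n)] [∀ n, Module R (M' n)]
    [∀ n, AddCommGroup (N' n)] [∀ n, Module R (N' n)]
    {dM' : ∀ n, M' (n + 1) →ₗ[R] M' n} {dN' : ∀ n, N' (n + 1) →ₗ[R] N' n}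
    {f' : ∀ n, M' n →ₗ[R] N' n}
    (i : ∀ n, M' n ≃ₗ[R] M n) (j : ∀ n, N' n ≃ₗ[R] N n)
    (hi : ∀ n x, i n (dM' n x) = dM n (i (n + 1) x))
    (hj : ∀ n x, j n (dN' n x) = dN n (j (n + 1) x))
    (hij : ∀ n x, j n (f' n x) = f n (i n x))
    (h : ConeExact R dM dN f) : ConeExact R dM' dN' f' := by
  constructor
  · intro y
    obtain ⟨x, y', h1⟩ := h.1 (j 0 y)
    refine ⟨(i 0).symm x, (j 1).symm y', (j 0).injective ?_⟩
    rw [map_sub, hij, hj]; simpa using h1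
  · intro n x y hx hxy
    obtain ⟨x', y', h1, h2⟩ := h.2 n (i n x) (j (n + 1) y) (by
      cases n with
      | zero => trivial
      | succ n =>
        simp only [IsCycleF] at *
        rw [← hi, hx, map_zero]) (by rw [← hij, hxy, hj])
    refine ⟨(i _).symm x', (j _).symm y', (i _).injective ?_, (j _).injective ?_⟩
    · rw [hi]; simpa using h1
    · rw [map_sub, hij, hj]; simpa using h2

lemma ConeExact.rTensor (hM : ∀ n, (dM n).comp (dM (n + 1)) = 0)
    (hN : ∀ n, (dN n).comp (dN (n + 1)) = 0)
    (hf : ∀ n, (f n).comp (dM n) = (dN n).comp (f (n + 1)))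
    (h : ConeExact R dM dN f) :
    ConeExact R (M := fun n => M n ⊗[R] Q) (N := fun n => N n ⊗[R] Q)
      (fun n => (dM n).rTensor Q) (fun n => (dN n).rTensor Q) (fun n => (f n).rTensor Q) := by
  refine ConeExact.transport (fun n => TensorProduct.comm R _ _)
    (fun n => TensorProduct.comm R _ _) ?_ ?_ ?_ (h.lTensor (Q := Q) hM hN hf)
  · intro n x
    induction x with
    | zero => simp
    | tmul a b => simp
    | add a b ha hb => simp only [map_add, ha, hb]
  · intro n x
    induction x with
    | zero => simp
    | tmul a b => simp
    | add a b ha hb => simp only [map_add, ha, hb]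
  · intro n x
    induction x with
    | zero => simp
    | tmul a b => simp
    | add a b ha hb => simp only [map_add, ha, hb]
end Flat2

section Total
variable {R}
variable {X Y : ℕ → ℕ → Type} {S T : ℕ → Type}
variable [∀ a b, AddCommGroup (X a b)] [∀ a b, Module R (X a b)]
variable [∀ a b, AddCommGroup (Y a b)] [∀ a b, Module R (Y a b)]
variable [∀ n, AddCommGroup (S n)] [∀ n, Module R (S n)]
variable [∀ n, AddCommGroup (T n)] [∀ n, Module R (T n)]

/-- `S` is the total graded module of the bigraded module `X`. -/
structure TotData (R : Type) [CommRing R] (X : ℕ → ℕ → Type) (S : ℕ → Type)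
    [∀ a b, AddCommGroup (X a b)] [∀ a b, Module R (X a b)]
    [∀ n, AddCommGroup (S n)] [∀ n, Module R (S n)] where
  /-- projections -/
  pr : ∀ n a b, a + b = n → S n →ₗ[R] X a b
  /-- inclusions -/
  inc : ∀ n a b, a + b = n → X a b →ₗ[R] S n
  ext0 : ∀ n (x : S n), (∀ a b h, pr n a b h x = 0) → x = 0
  pr_inc : ∀ n a b h z, pr n a b h (inc n a b h z) = z
  pr_inc_ne : ∀ n a b h z a' b' h', a' ≠ a → pr n a' b' h' (inc n a b h z) = 0

variable (PS : TotData R X S) (PT : TotData R Y T)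
  (hX : ∀ a b, X (a + 1) b →ₗ[R] X a b) (wX : ∀ a b, X a (b + 1) →ₗ[R] X a b)
  (hY : ∀ a b, Y (a + 1) b →ₗ[R] Y a b) (wY : ∀ a b, Y a (b + 1) →ₗ[R] Y a b)
  (g : ∀ a b, X a b →ₗ[R] Y a b)
  {dS : ∀ n, S (n + 1) →ₗ[R] S n} {dT : ∀ n, T (n + 1) →ₗ[R] T n}
  {f : ∀ n, S n →ₗ[R] T n}

theorem ConeExact.total
    (hdS : ∀ n, (dS n).comp (dS (n + 1)) = 0)
    (hdT : ∀ n, (dT n).comp (dT (n + 1)) = 0)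
    (hf : ∀ n, (f n).comp (dS n) = (dT n).comp (f (n + 1)))
    (hS : ∀ n a b h x, PS.pr n a b h (dS n x) =
      hX a b (PS.pr (n + 1) (a + 1) b (by omega) x) + wX a b (PS.pr (n + 1) a (b + 1) (by omega) x))
    (hT : ∀ n a b h x, PT.pr n a b h (dT n x) =
      hY a b (PT.pr (n + 1) (a + 1) b (by omega) x) + wY a b (PT.pr (n + 1) a (b + 1) (by omega) x))
    (hfg : ∀ n a b h x, PT.pr n a b h (f n x) = g a b (PS.pr n a b h x))
    (H : ∀ a, ConeExact R (wX a) (wY a) (g a)) : ConeExact R dS dT f := by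
  constructor
  · intro y
    obtain ⟨x, y', h1⟩ := (H 0).1 (PT.pr 0 0 0 rfl y)
    refine ⟨PS.inc 0 0 0 rfl x, PT.inc 1 0 1 rfl y', sub_eq_zero.1 (PT.ext0 _ _ ?_)⟩
    intro a b h
    obtain ⟨rfl, rfl⟩ : a = 0 ∧ b = 0 := by omega
    rw [map_sub, map_sub, hfg, hT, PS.pr_inc, PT.pr_inc, PT.pr_inc_ne _ _ _ _ _ _ _ _ (by omega),
      map_zero, zero_add, h1, sub_self]
  · intro n
    suffices hk : ∀ k (x : S n) (y : T (n + 1)), (∀ a b h, k ≤ a → PS.pr n a b h x = 0) →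
        (∀ a b h, k ≤ a → PT.pr (n + 1) a b h y = 0) → IsCycleF R dS n x → f n x = dT n y →
        ∃ (x' : S (n + 1)) (y' : T (n + 2)), dS n x' = x ∧ f (n + 1) x' - y = dT (n + 1) y' by
      intro x y hx hxy
      exact hk (n + 2) x y (fun a b h h' => by omega) (fun a b h h' => by omega) hx hxy
    intro k
    induction k with
    | zero =>
      intro x y hx hy _ _
      rw [PS.ext0 _ x (fun a b h => hx a b h (by omega)),
        PT.ext0 _ y (fun a b h => hy a b h (by omega))]
      exact ⟨0, 0, by simp, by simp⟩
    | succ k ih =>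
      intro x y hx hy hxc hxy
      -- the induction step reduces to finding a correction
      suffices hc : ∃ (x' : S (n + 1)) (y' : T (n + 2)),
          (∀ a b h, k ≤ a → PS.pr n a b h (x - dS n x') = 0) ∧
          (∀ a b h, k ≤ a → PT.pr (n + 1) a b h (y - f (n + 1) x' + dT (n + 1) y') = 0) by
        obtain ⟨x', y', h1, h2⟩ := hc
        have e1 := LinearMap.congr_fun (hf n) x'
        have e2 := LinearMap.congr_fun (hdT n) y'
        simp only [LinearMap.comp_apply, LinearMap.zero_apply] at e1 e2
        obtain ⟨x'', y'', h3, h4⟩ := ih _ _ h1 h2 (hxc.sub (IsCycleF.bdry hdS x')) (by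
          rw [map_sub, map_add, map_sub, e1, e2, hxy, add_zero])
        refine ⟨x' + x'', y' + y'', ?_, ?_⟩
        · rw [map_add, h3]; abel
        · rw [map_add, map_add, ← h4]; abel
      rcases Nat.lt_trichotomy k (n + 1) with hlt | rfl | hgt
      · obtain ⟨b, hb⟩ : ∃ b, k + b = n := ⟨n - k, by omega⟩
        obtain ⟨x', y', h1, h2⟩ := (H k).2 b (PS.pr n k b hb x) (PT.pr (n + 1) k (b + 1) (by omega) y)
          (by
            cases b with
            | zero => trivial
            | succ b =>
              obtain ⟨m, rfl⟩ : ∃ m, n = m + 1 := ⟨n - 1, by omega⟩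
              simp only [IsCycleF] at hxc ⊢
              have := hS m k b (by omega) x
              rw [hxc, map_zero, hx (k + 1) b _ le_rfl, map_zero, zero_add] at this
              exact this.symm)
          (by
            rw [← hfg, hxy, hT, hy (k + 1) b _ le_rfl, map_zero, zero_add])
        refine ⟨PS.inc (n + 1) k (b + 1) (by omega) x', PT.inc (n + 2) k (b + 2) (by omega) y', ?_, ?_⟩
        · intro a c h hka
          rw [map_sub, hS, PS.pr_inc_ne _ _ _ _ _ (a + 1) _ _ (by omega), map_zero, zero_add]
          rcases hka.eq_or_lt with rfl | hka
          · obtain rfl : c = b := by omega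
            rw [PS.pr_inc, h1, sub_self]
          · rw [PS.pr_inc_ne _ _ _ _ _ _ _ _ (by omega), hx _ _ _ hka, map_zero, sub_zero]
        · intro a c h hka
          rw [map_add, map_sub, hT, PT.pr_inc_ne _ _ _ _ _ (a + 1) _ _ (by omega), map_zero, zero_add,
            hfg]
          rcases hka.eq_or_lt with rfl | hka
          · obtain rfl : c = b + 1 := by omega
            rw [PS.pr_inc, PT.pr_inc, ← h2]; abel
          · rw [PS.pr_inc_ne _ _ _ _ _ _ _ _ (by omega), PT.pr_inc_ne _ _ _ _ _ _ _ _ (by omega),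
              hy _ _ _ hka, map_zero, map_zero]; abel
      · obtain ⟨x', y', h2⟩ := (H (n + 1)).1 (PT.pr (n + 1) (n + 1) 0 (by omega) y)
        refine ⟨PS.inc (n + 1) (n + 1) 0 (by omega) x', PT.inc (n + 2) (n + 1) 1 (by omega) y',
          fun a b h h' => by omega, ?_⟩
        intro a c h hka
        obtain ⟨rfl, rfl⟩ : a = n + 1 ∧ c = 0 := by omega
        rw [map_add, map_sub, hT, PT.pr_inc_ne _ _ _ _ _ (n + 1 + 1) _ _ (by omega), map_zero,
          zero_add, hfg, PS.pr_inc, PT.pr_inc, ← h2]; abel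
      · exact ⟨0, 0, fun a b h h' => by omega, fun a b h h' => by omega⟩
end Total

section Concrete
variable {R}

/-- Component of a graded tensor. -/
def gpr (M N : ℕ → Type)
    [∀ n, AddCommGroup (M n)] [∀ n, Module R (M n)]
    [∀ n, AddCommGroup (N n)] [∀ n, Module R (N n)] (n a b : ℕ) (h : a + b = n) :
    gradedTensor R M N n →ₗ[R] M a ⊗[R] N b :=
  DirectSum.component R (Idx n) (fun ab => M ab.1.1 ⊗[R] N ab.1.2) ⟨(a, b), h⟩

/-- Inclusion into a graded tensor. -/
def ginc (M N : ℕ → Type)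
    [∀ n, AddCommGroup (M n)] [∀ n, Module R (M n)]
    [∀ n, AddCommGroup (N n)] [∀ n, Module R (N n)] (n a b : ℕ) (h : a + b = n) :
    M a ⊗[R] N b →ₗ[R] gradedTensor R M N n :=
  DirectSum.lof R (Idx n) (fun ab => M ab.1.1 ⊗[R] N ab.1.2) ⟨(a, b), h⟩

variable {M N M' N' : ℕ → Type}
variable [∀ n, AddCommGroup (M n)] [∀ n, Module R (M n)]
variable [∀ n, AddCommGroup (N n)] [∀ n, Module R (N n)]
variable [∀ n, AddCommGroup (M' n)] [∀ n, Module R (M' n)]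
variable [∀ n, AddCommGroup (N' n)] [∀ n, Module R (N' n)]

lemma gpr_ginc (n a b : ℕ) (h : a + b = n) (z) : gpr (R := R) M N n a b h (ginc M N n a b h z) = z :=
  DirectSum.component.lof_self R _ _

lemma gpr_ginc_ne (n a b : ℕ) (h : a + b = n) (z) (a' b' : ℕ) (h' : a' + b' = n) (hne : a' ≠ a) :
    gpr (R := R) M N n a' b' h' (ginc M N n a b h z) = 0 := by
  unfold gpr ginc
  rw [DirectSum.component.of, dif_neg]
  intro e
  exact hne (congrArg (fun t : Idx n => t.1.1) e).symm

lemma gext (n : ℕ) (x y : gradedTensor R M N n)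
    (hx : ∀ a b h, gpr M N n a b h x = gpr M N n a b h y) : x = y := by
  refine DirectSum.ext_component R ?_
  rintro ⟨⟨a, b⟩, h⟩
  exact hx a b h

lemma gind (n : ℕ) {Z : Type} [AddCommGroup Z] [Module R Z] (F G : gradedTensor R M N n →ₗ[R] Z)
    (H : ∀ a b h z, F (ginc M N n a b h z) = G (ginc M N n a b h z)) (x) : F x = G x := by
  refine LinearMap.congr_fun (DirectSum.linearMap_ext R ?_) x
  rintro ⟨⟨a, b⟩, h⟩
  ext1
  ext1 m
  ext1 k
  exact H a b h _

lemma gpr_gmap (f : ∀ n, M n →ₗ[R] M' n) (g : ∀ n, N n →ₗ[R] N' n) (n a b : ℕ) (h : a + b = n) (x) :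
    gpr M' N' n a b h (gmap R f g n x) = TensorProduct.map (f a) (g b) (gpr M N n a b h x) := by
  refine gind n ((gpr M' N' n a b h).comp (gmap R f g n))
    ((TensorProduct.map (f a) (g b)).comp (gpr M N n a b h)) ?_ x
  intro a' b' h' z
  have e : gmap R f g n (ginc M N n a' b' h' z) =
      ginc M' N' n a' b' h' (TensorProduct.map (f a') (g b') z) := by
    simp [gmap, ginc]
  rw [LinearMap.comp_apply, LinearMap.comp_apply, e]
  by_cases ha : a = a'
  · subst ha
    obtain rfl : b = b' := by omega
    rw [gpr_ginc, gpr_ginc]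
  · rw [gpr_ginc_ne _ _ _ _ _ _ _ _ ha, gpr_ginc_ne _ _ _ _ _ _ _ _ ha, map_zero]

lemma gpr_D (dM : ∀ n, M (n + 1) →ₗ[R] M n) (dN : ∀ n, N (n + 1) →ₗ[R] N n)
    (n a b : ℕ) (h : a + b = n) (x) :
    gpr M N n a b h (gradedTensorD R dM dN n x) =
      (dM a).rTensor (N b) (gpr M N (n + 1) (a + 1) b (by omega) x) +
      ((-1 : ℤ) ^ a • (dN b).lTensor (M a)) (gpr M N (n + 1) a (b + 1) (by omega) x) := by
  refine gind (n + 1) ((gpr M N n a b h).comp (gradedTensorD R dM dN n))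
    (((dM a).rTensor (N b)).comp (gpr M N (n + 1) (a + 1) b (by omega)) +
      ((-1 : ℤ) ^ a • (dN b).lTensor (M a)).comp (gpr M N (n + 1) a (b + 1) (by omega))) ?_ x
  intro a' b' h' z
  have e : gradedTensorD R dM dN n (ginc M N (n + 1) a' b' h' z) = gtdAux R dM dN n a' b' h' z := by
    simp [gradedTensorD, ginc]
  have e1 : ∀ a' b' (h' : a' + 1 + b' = n + 1) z, gpr M N n a b h (ginc M N n a' b' (by omega)
      ((dM a').rTensor (N b') z)) = (dM a).rTensor (N b) (gpr M N (n + 1) (a + 1) b (by omega)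
      (ginc M N (n + 1) (a' + 1) b' h' z)) := by
    intro a' b' h' z
    by_cases ha : a = a'
    · subst ha
      obtain rfl : b = b' := by omega
      rw [gpr_ginc, gpr_ginc]
    · rw [gpr_ginc_ne _ _ _ _ _ _ _ _ ha, gpr_ginc_ne _ _ _ _ _ _ _ _ (by omega), map_zero]
  have e2 : ∀ a' b' (h' : a' + (b' + 1) = n + 1) z, gpr M N n a b h ((-1 : ℤ) ^ a' • ginc M N n a' b'
      (by omega) ((dN b').lTensor (M a') z)) = ((-1 : ℤ) ^ a • (dN b).lTensor (M a))
      (gpr M N (n + 1) a (b + 1) (by omega) (ginc M N (n + 1) a' (b' + 1) h' z)) := by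
    intro a' b' h' z
    by_cases ha : a = a'
    · subst ha
      obtain rfl : b = b' := by omega
      rw [map_zsmul, gpr_ginc, gpr_ginc]; rfl
    · rw [map_zsmul, gpr_ginc_ne _ _ _ _ _ _ _ _ ha, gpr_ginc_ne _ _ _ _ _ _ _ _ (by omega),
        map_zero, smul_zero]
  have e3 : ∀ b' (h' : 0 + b' = n + 1) z, gpr (R := R) M N (n + 1) (a + 1) b (by omega)
      (ginc M N (n + 1) 0 b' h' z) = 0 := fun b' h' z => gpr_ginc_ne _ _ _ _ _ _ _ _ (by omega)
  have e4 : ∀ a' (h' : a' + 0 = n + 1) z, gpr (R := R) M N (n + 1) a (b + 1) (by omega)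
      (ginc M N (n + 1) a' 0 h' z) = 0 := fun b' h' z => gpr_ginc_ne _ _ _ _ _ _ _ _ (by omega)
  rw [LinearMap.comp_apply, LinearMap.add_apply, LinearMap.comp_apply, LinearMap.comp_apply, e,
    gtdAux.eq_def, LinearMap.add_apply, map_add]
  congr 1
  · cases a' with
    | zero => rw [e3]; simp
    | succ a' => exact e1 a' b' h' z
  · cases b' with
    | zero => rw [e4]; simp
    | succ b' => exact e2 a' b' h' z

lemma gD_sq (dM : ∀ n, M (n + 1) →ₗ[R] M n) (dN : ∀ n, N (n + 1) →ₗ[R] N n)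
    (hM : ∀ n, (dM n).comp (dM (n + 1)) = 0) (hN : ∀ n, (dN n).comp (dN (n + 1)) = 0) (n : ℕ) :
    (gradedTensorD R dM dN n).comp (gradedTensorD R dM dN (n + 1)) = 0 := by
  refine LinearMap.ext fun x => ?_
  refine gext _ _ _ fun a b h => ?_
  have h1 : ∀ z, (dM a).rTensor (N b) ((dM (a + 1)).rTensor (N b) z) = 0 := fun z => by
    rw [← LinearMap.rTensor_comp_apply, hM, LinearMap.rTensor_zero, LinearMap.zero_apply]
  have h2 : ∀ z, (dN b).lTensor (M a) ((dN (b + 1)).lTensor (M a) z) = 0 := fun z => by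
    rw [← LinearMap.lTensor_comp_apply, hN, LinearMap.lTensor_zero, LinearMap.zero_apply]
  have h3 : ∀ z, (dM a).rTensor (N b) ((dN b).lTensor (M (a + 1)) z) =
      (dN b).lTensor (M a) ((dM a).rTensor (N (b + 1)) z) := fun z => by
    rw [← LinearMap.comp_apply, ← LinearMap.comp_apply, LinearMap.rTensor_comp_lTensor,
      LinearMap.lTensor_comp_rTensor]
  rw [LinearMap.comp_apply, LinearMap.zero_apply, map_zero, gpr_D, gpr_D, gpr_D]
  simp only [map_add, LinearMap.smul_apply, map_zsmul, h1, h2, h3, smul_zero, add_zero, zero_add,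
    pow_succ]
  simp

lemma map_map_elt {M1 M2 M3 N1 N2 N3 : Type} [AddCommGroup M1] [Module R M1]
    [AddCommGroup M2] [Module R M2] [AddCommGroup M3] [Module R M3]
    [AddCommGroup N1] [Module R N1] [AddCommGroup N2] [Module R N2]
    [AddCommGroup N3] [Module R N3]
    (f : M1 →ₗ[R] M2) (f' : M2 →ₗ[R] M3) (g : N1 →ₗ[R] N2) (g' : N2 →ₗ[R] N3) (z : M1 ⊗[R] N1) :
    TensorProduct.map f' g' (TensorProduct.map f g z) =
      TensorProduct.map (f'.comp f) (g'.comp g) z := by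
  rw [TensorProduct.map_comp, LinearMap.comp_apply]

lemma gmap_comm {dM : ∀ n, M (n + 1) →ₗ[R] M n} {dN : ∀ n, N (n + 1) →ₗ[R] N n}
    {dM' : ∀ n, M' (n + 1) →ₗ[R] M' n} {dN' : ∀ n, N' (n + 1) →ₗ[R] N' n}
    {f : ∀ n, M n →ₗ[R] M' n} {g : ∀ n, N n →ₗ[R] N' n}
    (hf : ∀ n, (f n).comp (dM n) = (dM' n).comp (f (n + 1)))
    (hg : ∀ n, (g n).comp (dN n) = (dN' n).comp (g (n + 1))) (n : ℕ) :
    (gmap R f g n).comp (gradedTensorD R dM dN n) =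
      (gradedTensorD R dM' dN' n).comp (gmap R f g (n + 1)) := by
  refine LinearMap.ext fun x => ?_
  refine gext _ _ _ fun a b h => ?_
  rw [LinearMap.comp_apply, LinearMap.comp_apply, gpr_gmap, gpr_D, gpr_D, gpr_gmap, gpr_gmap,
    map_add]
  congr 1
  · simp only [LinearMap.rTensor, map_map_elt, hf,
      LinearMap.id_comp, LinearMap.comp_id]
  · rw [LinearMap.smul_apply, LinearMap.smul_apply, map_zsmul]
    simp only [LinearMap.lTensor, map_map_elt, hg,
      LinearMap.id_comp, LinearMap.comp_id]

/-- total data, filtered by the first degree -/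
def totL (R : Type) [CommRing R] (M N : ℕ → Type)
    [∀ n, AddCommGroup (M n)] [∀ n, Module R (M n)]
    [∀ n, AddCommGroup (N n)] [∀ n, Module R (N n)] :
    TotData R (fun a b => M a ⊗[R] N b) (gradedTensor R M N) where
  pr := gpr M N
  inc := ginc M N
  ext0 n x hx := gext n x 0 fun a b h => by rw [hx, map_zero]
  pr_inc := gpr_ginc
  pr_inc_ne := gpr_ginc_ne

/-- total data, filtered by the second degree -/
def totR (R : Type) [CommRing R] (M N : ℕ → Type)
    [∀ n, AddCommGroup (M n)] [∀ n, Module R (M n)]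
    [∀ n, AddCommGroup (N n)] [∀ n, Module R (N n)] :
    TotData R (fun a b => M b ⊗[R] N a) (gradedTensor R M N) where
  pr n a b h := gpr M N n b a (by omega)
  inc n a b h := ginc M N n b a (by omega)
  ext0 n x hx := gext n x 0 fun a b h => by rw [hx b a (by omega), map_zero]
  pr_inc _ _ _ _ := gpr_ginc _ _ _ _
  pr_inc_ne _ _ _ _ _ _ _ _ _ := gpr_ginc_ne _ _ _ _ _ _ _ _ (by omega)

lemma qiso_left [∀ n, Module.Flat R (M n)]
    {dM : ∀ n, M (n + 1) →ₗ[R] M n} {dN : ∀ n, N (n + 1) →ₗ[R] N n}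
    {dN' : ∀ n, N' (n + 1) →ₗ[R] N' n} {g : ∀ n, N n →ₗ[R] N' n}
    (hM : ∀ n, (dM n).comp (dM (n + 1)) = 0) (hN : ∀ n, (dN n).comp (dN (n + 1)) = 0)
    (hN' : ∀ n, (dN' n).comp (dN' (n + 1)) = 0)
    (hg : ∀ n, (g n).comp (dN n) = (dN' n).comp (g (n + 1)))
    (h : IsQIsoF R dN dN' g) :
    IsQIsoF R (gradedTensorD R dM dN) (gradedTensorD R dM dN')
      (gmap R (fun _ => LinearMap.id) g) := by
  have hc := ConeExact.of_qiso hg h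
  refine (ConeExact.total (totL R M N) (totL R M N') (fun a b => (dM a).rTensor (N b))
    (fun a b => (-1 : ℤ) ^ a • (dN b).lTensor (M a)) (fun a b => (dM a).rTensor (N' b))
    (fun a b => (-1 : ℤ) ^ a • (dN' b).lTensor (M a)) (fun a b => (g b).lTensor (M a))
    (gD_sq _ _ hM hN) (gD_sq _ _ hM hN') (gmap_comm (fun n => rfl) hg)
    (fun n a b h x => gpr_D _ _ n a b h x) (fun n a b h x => gpr_D _ _ n a b h x)
    (fun n a b h x => gpr_gmap _ _ n a b h x) ?_).qiso
  intro a
  refine ConeExact.smul ((-1) ^ a) ?_ (hc.lTensor (Q := M a) hN hN' hg)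
  rw [← mul_pow]; simp

lemma qiso_right [∀ n, Module.Flat R (N n)]
    {dM : ∀ n, M (n + 1) →ₗ[R] M n} {dN : ∀ n, N (n + 1) →ₗ[R] N n}
    {dM' : ∀ n, M' (n + 1) →ₗ[R] M' n} {f : ∀ n, M n →ₗ[R] M' n}
    (hM : ∀ n, (dM n).comp (dM (n + 1)) = 0) (hN : ∀ n, (dN n).comp (dN (n + 1)) = 0)
    (hM' : ∀ n, (dM' n).comp (dM' (n + 1)) = 0)
    (hf : ∀ n, (f n).comp (dM n) = (dM' n).comp (f (n + 1)))
    (h : IsQIsoF R dM dM' f) :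
    IsQIsoF R (gradedTensorD R dM dN) (gradedTensorD R dM' dN)
      (gmap R f (fun _ => LinearMap.id)) := by
  have hc := ConeExact.of_qiso hf h
  refine (ConeExact.total (totR R M N) (totR R M' N)
    (fun a b => (-1 : ℤ) ^ b • (dN a).lTensor (M b)) (fun a b => (dM b).rTensor (N a))
    (fun a b => (-1 : ℤ) ^ b • (dN a).lTensor (M' b)) (fun a b => (dM' b).rTensor (N a))
    (fun a b => (f b).rTensor (N a))
    (gD_sq _ _ hM hN) (gD_sq _ _ hM' hN) (gmap_comm hf (fun n => rfl))
    (fun n a b h x => (gpr_D _ _ n b a _ x).trans (add_comm _ _))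
    (fun n a b h x => (gpr_D _ _ n b a _ x).trans (add_comm _ _))
    (fun n a b h x => gpr_gmap _ _ n b a _ x) ?_).qiso
  intro a
  exact hc.rTensor (Q := N a) hM hM' hf

end Concrete
end Helpers

/-- Over a commutative ring, the tensor product of two quasi-isomorphisms
between complexes of flat modules is a quasi-isomorphism. -/
theorem tensor_of_qisos_between_flat_complexes
    (R : Type) [CommRing R]
    (A A' B B' : ℕ → Type)
    [∀ n, AddCommGroup (A n)] [∀ n, Module R (A n)]
    [∀ n, AddCommGroup (A' n)] [∀ n, Module R (A' n)]
    [∀ n, AddCommGroup (B n)] [∀ n, Module R (B n)]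
    [∀ n, AddCommGroup (B' n)] [∀ n, Module R (B' n)]
    [∀ n, Module.Flat R (A n)] [∀ n, Module.Flat R (A' n)]
    [∀ n, Module.Flat R (B n)] [∀ n, Module.Flat R (B' n)]
    (dA : ∀ n, A (n + 1) →ₗ[R] A n) (hdA : ∀ n, (dA n).comp (dA (n + 1)) = 0)
    (dA' : ∀ n, A' (n + 1) →ₗ[R] A' n) (hdA' : ∀ n, (dA' n).comp (dA' (n + 1)) = 0)
    (dB : ∀ n, B (n + 1) →ₗ[R] B n) (hdB : ∀ n, (dB n).comp (dB (n + 1)) = 0)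
    (dB' : ∀ n, B' (n + 1) →ₗ[R] B' n) (hdB' : ∀ n, (dB' n).comp (dB' (n + 1)) = 0)
    (u : ∀ n, A n →ₗ[R] A' n)
    (hu : ∀ n, (u n).comp (dA n) = (dA' n).comp (u (n + 1)))
    (hqu : IsQIsoF R dA dA' u)
    (v : ∀ n, B n →ₗ[R] B' n)
    (hv : ∀ n, (v n).comp (dB n) = (dB' n).comp (v (n + 1)))
    (hqv : IsQIsoF R dB dB' v) :
    IsQIsoF R (gradedTensorD R dA dB) (gradedTensorD R dA' dB') (gmap R u v) := by
  have h1 : IsQIsoF R (gradedTensorD R dA dB) (gradedTensorD R dA dB')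
      (gmap R (fun _ => LinearMap.id) v) := qiso_left hdA hdB hdB' hv hqv
  have h2 : IsQIsoF R (gradedTensorD R dA dB') (gradedTensorD R dA' dB')
      (gmap R u (fun _ => LinearMap.id)) := qiso_right hdA hdB' hdA' hu hqu
  have h3 := h1.comp (gmap_comm (f := fun _ => LinearMap.id) (fun n => rfl) hv)
    (gmap_comm (g := fun _ => LinearMap.id) hu (fun n => rfl)) h2
  have e : gmap R u v = fun n => (gmap R u (fun n => (LinearMap.id : B' n →ₗ[R] B' n)) n).comp
      (gmap R (fun n => (LinearMap.id : A n →ₗ[R] A n)) v n) := by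
    funext n
    refine LinearMap.ext fun x => ?_
    refine gext _ _ _ fun a b h => ?_
    rw [LinearMap.comp_apply, gpr_gmap, gpr_gmap, gpr_gmap, map_map_elt, LinearMap.id_comp, LinearMap.comp_id]
  rw [e]
  exact h3

end
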